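/- arXiv:1003.3998 — 2 statements merged into one kernel-verified Lean document; each statement's English description precedes it below -/
import Mathlib

section
/- For all integers p, q ≥ 2, the torus knot group Γ_{p,q} = ⟨x, y | xᵖ = y^q⟩ belongs to the class 𝒜. -/
/-- A `G`-invariant mean on `X`, for the `G`-action on `X` given by `φ`:
a finitely additive probability "measure" on the subsets of `X` invariant under `G`. -/
def IsInvariantMean {G X : Type*} [Group G] (φ : G →* Equiv.Perm X)
    (μ : Set X → ℝ) : Prop :=
  (∀ S : Set X, 0 ≤ μ S) ∧ μ Set.univ = 1 ∧
  (∀ S T : Set X, Disjoint S T → μ (S ∪ T) = μ S + μ T) ∧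
  (∀ (g : G) (S : Set X), μ ((φ g) '' S) = μ S)

/-- The action of `G` on `X` given by `φ` is amenable: there is a `G`-invariant mean on `X`. -/
def AmenableAction {G X : Type*} [Group G] (φ : G →* Equiv.Perm X) : Prop :=
  ∃ μ : Set X → ℝ, IsInvariantMean φ μ

/-- A group is amenable if its left-translation action on itself is amenable. -/
def AmenableGroup (G : Type*) [Group G] : Prop :=
  AmenableAction (MulAction.toPermHom G G)

/-- A group `G` is in the class `𝒜` if it admits a transitive, faithful and
amenable action on some countable set. -/
def InClassA (G : Type*) [Group G] : Prop :=
  ∃ (X : Type) (_ : Countable X) (φ : G →* Equiv.Perm X),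
    Function.Injective φ ∧ (∀ x y : X, ∃ g : G, φ g x = y) ∧ AmenableAction φ

/-- `(P, jG, jH)` is the amalgamated free product of `G` and `H` over `A`
(along the homomorphisms `iG : A →* G` and `iH : A →* H`), i.e. it is a pushout
of `iG` and `iH` in the category of groups. -/
def IsAmalgamatedProduct {A G H P : Type*} [Group A] [Group G] [Group H] [Group P]
    (iG : A →* G) (iH : A →* H) (jG : G →* P) (jH : H →* P) : Prop :=
  jG.comp iG = jH.comp iH ∧
  ∀ (L : Type) [Group L] (fG : G →* L) (fH : H →* L),
    fG.comp iG = fH.comp iH → ∃! f : P →* L, f.comp jG = fG ∧ f.comp jH = fH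

/-- The torus knot group `Γ_{p,q} = ⟨x, y | xᵖ = y^q⟩`, presented with two generators
`x = FreeGroup.of true`, `y = FreeGroup.of false` and the single relation `xᵖ * (y^q)⁻¹`. -/
def TorusKnotGroup (p q : ℕ) : Type :=
  PresentedGroup ({FreeGroup.of true ^ p * (FreeGroup.of false ^ q)⁻¹} : Set (FreeGroup Bool))

instance (p q : ℕ) : Group (TorusKnotGroup p q) := by
  unfold TorusKnotGroup; infer_instance

open Filter Topology in
/-- A sequence of finite sets that is asymptotically invariant under a generating set of `G`
yields a `G`-invariant mean on the ambient set. -/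
theorem exists_isInvariantMean_of_folner {G Y : Type*} [Group G] (φ : G →* Equiv.Perm Y)
    {S : Set G} (hS : Subgroup.closure S = ⊤) (E : ℕ → Set Y) (hfin : ∀ n, (E n).Finite)
    (hne : ∀ᶠ n in atTop, (E n).Nonempty)
    (hE : ∀ s ∈ S, Tendsto
      (fun n => (({e ∈ E n | φ s e ∉ E n}.ncard : ℝ) / (E n).ncard)) atTop (𝓝 0)) :
    ∃ μ : Set Y → ℝ, IsInvariantMean φ μ ∧
      ∀ T : Set Y, (∀ n, E n ⊆ T) → μ T = 1 := by
  classical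
  let U : Ultrafilter ℕ := hyperfilter ℕ
  have hU : (U : Filter ℕ) ≤ atTop := by
    rw [← Nat.cofinite_eq_atTop]; exact hyperfilter_le_cofinite
  let d : Set Y → ℕ → ℝ := fun T n => ((E n ∩ T).ncard : ℝ) / (E n).ncard
  have hd0 : ∀ T n, 0 ≤ d T n := fun T n => by positivity
  have hd1 : ∀ T n, d T n ≤ 1 := fun T n => by
    refine div_le_one_of_le₀ ?_ (by positivity)
    exact_mod_cast Set.ncard_le_ncard Set.inter_subset_left (hfin n)
  have hlim : ∀ T, ∃ x, Tendsto (d T) U (𝓝 x) := fun T => by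
    obtain ⟨x, -, hx⟩ := (isCompact_Icc (a := (0 : ℝ)) (b := 1)).ultrafilter_le_nhds
      (U.map (d T)) (by
        rw [le_principal_iff]
        exact Filter.mem_map.2 (Filter.mem_of_superset univ_mem fun n _ => ⟨hd0 T n, hd1 T n⟩))
    exact ⟨x, hx⟩
  choose μ hμ using hlim
  have hone : ∀ T : Set Y, (∀ n, E n ⊆ T) → μ T = 1 := fun T hT => by
    refine tendsto_nhds_unique (hμ T) (tendsto_const_nhds.congr' ?_)
    filter_upwards [hU hne] with n hn
    have : (E n).ncard ≠ 0 := (Set.ncard_pos (hfin n)).2 hn |>.ne'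
    simp only [d, Set.inter_eq_left.2 (hT n)]
    rw [div_self (by exact_mod_cast this)]
  have hadd : ∀ S T : Set Y, Disjoint S T → μ (S ∪ T) = μ S + μ T := fun S T hST => by
    refine tendsto_nhds_unique (hμ _) (((hμ S).add (hμ T)).congr fun n => ?_)
    simp only [d]
    rw [← add_div, Set.inter_union_distrib_left, Set.ncard_union_eq
      (hST.mono Set.inter_subset_right Set.inter_subset_right)
      ((hfin n).subset Set.inter_subset_left) ((hfin n).subset Set.inter_subset_left)]
    push_cast
    rfl
  have huniv : μ Set.univ = 1 := hone _ fun n => Set.subset_univ _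
  have hle : ∀ s ∈ S, ∀ T, μ T ≤ μ (φ s '' T) := fun s hs T => by
    have h := (hμ (φ s '' T)).add ((hE s hs).mono_left hU)
    rw [add_zero] at h
    refine le_of_tendsto_of_tendsto' (hμ T) h fun n => ?_
    simp only [d]
    rw [← add_div]
    refine div_le_div_of_nonneg_right ?_ (by positivity)
    have h1 : E n ∩ T ⊆ (φ s) ⁻¹' (E n ∩ φ s '' T) ∪ {e ∈ E n | φ s e ∉ E n} := by
      rintro e ⟨he, heT⟩
      by_cases h : φ s e ∈ E n
      · exact Or.inl ⟨h, e, heT, rfl⟩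
      · exact Or.inr ⟨he, h⟩
    have hf : ((φ s) ⁻¹' (E n ∩ φ s '' T)).Finite :=
      ((hfin n).subset Set.inter_subset_left).preimage (φ s).injective.injOn
    have h2 := (Set.ncard_le_ncard h1 (hf.union ((hfin n).subset (Set.sep_subset _ _)))).trans
      (Set.ncard_union_le _ _)
    rw [Set.ncard_preimage_of_injective_subset_range (φ s).injective
      (fun x _ => (φ s).surjective x)] at h2
    exact_mod_cast h2
  have heq : ∀ s ∈ S, ∀ T, μ (φ s '' T) = μ T := fun s hs T => by
    have h1 := hle s hs T
    have h2 := hle s hs Tᶜ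
    rw [Set.image_compl_eq (φ s).bijective] at h2
    have h3 := hadd T Tᶜ disjoint_compl_right
    have h4 := hadd (φ s '' T) (φ s '' T)ᶜ disjoint_compl_right
    rw [Set.union_compl_self] at h3 h4
    linarith
  refine ⟨μ, ⟨fun T => ge_of_tendsto' (hμ T) (hd0 T), huniv, hadd, fun g => ?_⟩, hone⟩
  have hg : g ∈ Subgroup.closure S := hS ▸ Subgroup.mem_top g
  induction hg using Subgroup.closure_induction with
  | mem s hs => exact heq s hs
  | one => simp
  | mul g h _ _ ihg ihh =>
    intro T
    rw [map_mul, Equiv.Perm.coe_mul, Set.image_comp, ihg, ihh]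
  | inv g _ ih =>
    intro T
    rw [← ih, ← Set.image_comp, ← Equiv.Perm.coe_mul, ← map_mul]
    simp

open Filter Topology in
/-- If some orbit of a `G`-action contains an asymptotically invariant sequence of finite sets and
`G` acts faithfully on this orbit, then `G` belongs to the class `𝒜`. -/
theorem inClassA_of_orbit {G : Type*} [Group G] [Countable G] {Y : Type} (φ : G →* Equiv.Perm Y)
    (y : Y) (hfaith : ∀ g, (∀ h, φ g (φ h y) = φ h y) → g = 1)
    {S : Set G} (hS : Subgroup.closure S = ⊤) (E : ℕ → Set Y) (hfin : ∀ n, (E n).Finite)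
    (hne : ∀ᶠ n in atTop, (E n).Nonempty) (hsub : ∀ n, E n ⊆ Set.range fun g => φ g y)
    (hE : ∀ s ∈ S, Tendsto
      (fun n => (({e ∈ E n | φ s e ∉ E n}.ncard : ℝ) / (E n).ncard)) atTop (𝓝 0)) :
    InClassA G := by
  obtain ⟨μ, ⟨h0, h1, hadd, hinv⟩, hone⟩ := exists_isInvariantMean_of_folner φ hS E hfin hne hE
  let X := {z : Y // z ∈ Set.range fun g => φ g y}
  have hX : ∀ g z, φ g z ∈ (Set.range fun g => φ g y) ↔ z ∈ Set.range fun g => φ g y := by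
    intro g z
    constructor
    · rintro ⟨h, hh⟩
      exact ⟨g⁻¹ * h, by simp only at hh; simp [hh]⟩
    · rintro ⟨h, rfl⟩
      exact ⟨g * h, by simp⟩
  let ψ : G →* Equiv.Perm X := MonoidHom.mk' (fun g => (φ g).subtypePerm (hX g)) fun g h => by
    ext z; simp
  have hψ : ∀ g (z : X), (ψ g z : Y) = φ g z := fun g z => rfl
  refine ⟨X, (Set.countable_range _).to_subtype, ψ, ?_, ?_, fun T => μ (Subtype.val '' T),
    fun T => h0 _, ?_, fun A B hAB => ?_, fun g T => ?_⟩
  · rw [injective_iff_map_eq_one]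
    intro g hg
    refine hfaith g fun h => ?_
    have := hψ g ⟨φ h y, h, rfl⟩
    rw [hg] at this
    exact this.symm
  · rintro ⟨_, g, rfl⟩ ⟨_, h, rfl⟩
    exact ⟨h * g⁻¹, Subtype.ext (by rw [hψ]; simp)⟩
  · exact hone _ fun n e he => ⟨⟨e, hsub n he⟩, trivial, rfl⟩
  · simp only [Set.image_union]
    exact hadd _ _ ((Set.disjoint_image_iff Subtype.val_injective).2 hAB)
  · simp only
    rw [← hinv g (Subtype.val '' T), ← Set.image_comp, ← Set.image_comp]
    rfl

section FreeProduct

open Monoid CoprodI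

variable {ι : Type*} {M : ι → Type*} [∀ i, Group (M i)]

open Classical in
/-- The action of a free product on itself in which the factor `M i` acts by left multiplication
on the invariant set `C i`, and trivially outside of it. -/
noncomputable def truncatedMul (C : ι → Set (CoprodI M))
    (hC : ∀ i (m : M i), ∀ w ∈ C i, of m * w ∈ C i) : CoprodI M →* Equiv.Perm (CoprodI M) :=
  lift fun i => MonoidHom.toHomPerm
    { toFun := fun m w => if w ∈ C i then of m * w else w
      map_one' := funext fun w => by
        change (if w ∈ C i then of (1 : M i) * w else w) = w
        simp
      map_mul' := fun m m' => funext fun w => by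
        change (if w ∈ C i then of (m * m') * w else w) =
          if (if w ∈ C i then of m' * w else w) ∈ C i
          then of m * (if w ∈ C i then of m' * w else w) else if w ∈ C i then of m' * w else w
        by_cases hw : w ∈ C i
        · simp [hw, hC i m' w hw, mul_assoc]
        · simp [hw] }

theorem truncatedMul_of_mem {C : ι → Set (CoprodI M)}
    (hC : ∀ i (m : M i), ∀ w ∈ C i, of m * w ∈ C i) {i : ι} (m : M i) {w : CoprodI M}
    (hw : w ∈ C i) : truncatedMul C hC (of m) w = of m * w := by
  rw [truncatedMul, lift_of]
  exact if_pos hw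

theorem truncatedMul_of_notMem {C : ι → Set (CoprodI M)}
    (hC : ∀ i (m : M i), ∀ w ∈ C i, of m * w ∈ C i) {i : ι} (m : M i) {w : CoprodI M}
    (hw : w ∉ C i) : truncatedMul C hC (of m) w = w := by
  rw [truncatedMul, lift_of]
  exact if_neg hw

/-- The elements of a free product whose reduced word ends with a letter of `M j`. -/
def endsIn (M : ι → Type*) [∀ i, Group (M i)] (j : ι) : Set (CoprodI M) :=
  {w | ∃ (i : ι) (n : NeWord M i j), n.prod = w}

theorem truncatedMul_prod {C : ι → Set (CoprodI M)}
    (hC : ∀ i (m : M i), ∀ w ∈ C i, of m * w ∈ C i) {l : ι} (hl : ∀ i, endsIn M l ⊆ C i)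
    {i j : ι} (u : NeWord M i j) {k : ι} (v : NeWord M k l) (hjk : j ≠ k) :
    truncatedMul C hC u.prod v.prod = u.prod * v.prod := by
  induction u generalizing k with
  | singleton m hm =>
    rw [NeWord.prod_singleton]
    exact truncatedMul_of_mem hC m (hl _ ⟨_, v, rfl⟩)
  | append u₁ hne u₂ ih₁ ih₂ =>
    rw [NeWord.append_prod, map_mul, Equiv.Perm.mul_apply, ih₂ v hjk,
      ← NeWord.append_prod (hne := hjk), ih₁ _ hne, NeWord.append_prod, mul_assoc]

theorem NeWord_of_mul_prod {i j k : ι} (n : NeWord M i j) (m : M k) :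
    (of m * n.prod = 1 ∧ k = j) ∨ ∃ (i' : ι) (n' : NeWord M i' j), n'.prod = of m * n.prod := by
  by_cases hm : m = 1
  · exact Or.inr ⟨i, n, by simp [hm]⟩
  by_cases hki : k = i
  · subst hki
    induction n with
    | singleton x hx =>
      by_cases h : m * x = 1
      · exact Or.inl ⟨by rw [NeWord.prod_singleton, ← map_mul, h, map_one], rfl⟩
      · exact Or.inr ⟨_, .singleton _ h, by simp⟩
    | append n₁ hne n₂ ih₁ _ =>
      rw [NeWord.append_prod, ← mul_assoc]
      obtain ⟨h, -⟩ | ⟨i', n', h⟩ := ih₁ m hm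
      · exact Or.inr ⟨_, n₂, by simp [h]⟩
      · exact Or.inr ⟨i', n'.append hne n₂, by simp [h]⟩
  · exact Or.inr ⟨k, (NeWord.singleton m hm).append hki n, by simp⟩

theorem of_mul_mem_endsIn {j : ι} {w : CoprodI M} (hw : w ∈ endsIn M j) {k : ι} (m : M k) :
    (of m * w = 1 ∧ k = j) ∨ of m * w ∈ endsIn M j := by
  obtain ⟨i, n, rfl⟩ := hw
  exact NeWord_of_mul_prod n m

theorem NeWord_toList_eq_of_prod_eq {i j i' j' : ι} {n : NeWord M i j} {n' : NeWord M i' j'}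
    (h : n.prod = n'.prod) : n.toList = n'.toList := by
  classical
  exact congrArg Word.toList (Word.equiv.symm.injective (a₁ := n.toWord) (a₂ := n'.toWord) h)

theorem NeWord_prod_ne_one {i j : ι} (n : NeWord M i j) : n.prod ≠ 1 := by
  classical
  intro h
  have := congrArg Word.toList
    (Word.equiv.symm.injective (a₁ := n.toWord) (a₂ := Word.empty) (h.trans Word.prod_empty.symm))
  exact n.toList_ne_nil this

theorem NeWord_head_eq_of_prod_eq {i j i' j' : ι} {n : NeWord M i j} {n' : NeWord M i' j'}
    (h : n.prod = n'.prod) : (⟨i, n.head⟩ : Σ i, M i) = ⟨i', n'.head⟩ := by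
  have := congrArg List.head? (NeWord_toList_eq_of_prod_eq h)
  simpa only [NeWord.toList_head?, Option.some.injEq] using this

theorem NeWord_last_idx_eq_of_prod_eq {i j i' j' : ι} {n : NeWord M i j} {n' : NeWord M i' j'}
    (h : n.prod = n'.prod) : j = j' := by
  have := congrArg List.getLast? (NeWord_toList_eq_of_prod_eq h)
  simp only [NeWord.toList_getLast?, Option.some.injEq] at this
  exact congrArg Sigma.fst this

theorem exists_NeWord_prod_eq {w : CoprodI M} (hw : w ≠ 1) :
    ∃ (i j : ι) (n : NeWord M i j), n.prod = w := by
  classical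
  have h : Word.equiv w ≠ Word.empty := fun h => hw <| by
    rw [← Word.equiv.symm_apply_apply w, h]; rfl
  obtain ⟨i, j, n, hn⟩ := NeWord.of_word _ h
  exact ⟨i, j, n, by rw [NeWord.prod, hn]; exact Word.equiv.symm_apply_apply w⟩

end FreeProduct

section Trunk

open Monoid CoprodI

variable {M : Bool → Type*} [∀ i, Group (M i)] (α : M true) (β : M false)

/-- The set on which each factor acts by left multiplication: the elements whose reduced word ends
in `M false`, together with the cosets met by the ray `1, α, βα, αβα, …`. -/
def trunkDomain : Bool → Set (CoprodI M)
  | true => endsIn M false ∪ {w | ∃ (m : ℕ) (u : M true), w = of u * (of β * of α) ^ m}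
  | false => endsIn M false ∪ Set.range (of : M false →* CoprodI M) ∪
      {w | ∃ (m : ℕ) (u : M false), w = of u * (of α * (of β * of α) ^ m)}

/-- The first `2 * n` cosets met by the ray `1, α, βα, αβα, …`. -/
def trunk (n : ℕ) : Set (CoprodI M) :=
  {w | ∃ m < n, (∃ u : M true, w = of u * (of β * of α) ^ m) ∨
    ∃ u : M false, w = of u * (of α * (of β * of α) ^ m)}

theorem endsIn_subset_trunkDomain (i : Bool) : endsIn M false ⊆ trunkDomain α β i := by
  cases i
  · exact fun w hw => Or.inl (Or.inl hw)
  · exact fun w hw => Or.inl hw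

theorem of_mul_mem_trunkDomain (i : Bool) (m : M i) (w : CoprodI M) (hw : w ∈ trunkDomain α β i) :
    of m * w ∈ trunkDomain α β i := by
  cases i
  · obtain (hw | ⟨u, rfl⟩) | ⟨k, u, rfl⟩ := hw
    · obtain ⟨h, -⟩ | h := of_mul_mem_endsIn hw m
      · exact Or.inl (Or.inr ⟨1, by rw [h, map_one]⟩)
      · exact Or.inl (Or.inl h)
    · exact Or.inl (Or.inr ⟨m * u, map_mul _ _ _⟩)
    · exact Or.inr ⟨k, m * u, by rw [map_mul, mul_assoc]⟩
  · obtain hw | ⟨k, u, rfl⟩ := hw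
    · obtain ⟨-, h⟩ | h := of_mul_mem_endsIn hw m
      · cases h
      · exact Or.inl h
    · exact Or.inr ⟨k, m * u, by rw [map_mul, mul_assoc]⟩

variable {α β}

theorem exists_NeWord_pow (hα : α ≠ 1) (hβ : β ≠ 1) (m : ℕ) :
    ∃ n : NeWord M false true, n.head = β ∧ n.prod = (of β * of α) ^ (m + 1) := by
  induction m with
  | zero => exact ⟨(NeWord.singleton β hβ).append (by simp) (.singleton α hα), by simp⟩
  | succ m ih =>
    obtain ⟨n, -, hn⟩ := ih
    exact ⟨((NeWord.singleton β hβ).append (by simp) (.singleton α hα)).append (by simp) n, by simp,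
      by simp [hn, pow_succ' _ (m + 1)]⟩

theorem exists_NeWord_of_mul_pow (hα : α ≠ 1) (hβ : β ≠ 1) {u : M true} (hu : u ≠ 1) (m : ℕ) :
    ∃ n : NeWord M true true, n.head = u ∧ n.prod = of u * (of β * of α) ^ m := by
  cases m with
  | zero => exact ⟨.singleton u hu, by simp⟩
  | succ m =>
    obtain ⟨n, -, hn⟩ := exists_NeWord_pow hα hβ m
    exact ⟨(NeWord.singleton u hu).append (by simp) n, by simp [hn]⟩

theorem exists_NeWord_of_mul_of_mul_pow (hα : α ≠ 1) (hβ : β ≠ 1) {u : M false} (hu : u ≠ 1)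
    (m : ℕ) :
    ∃ n : NeWord M false true, n.head = u ∧ n.prod = of u * (of α * (of β * of α) ^ m) := by
  obtain ⟨n, -, hn⟩ := exists_NeWord_of_mul_pow hα hβ hα m
  exact ⟨(NeWord.singleton u hu).append (by simp) n, by simp [hn]⟩

theorem pow_mul_injective (hα : α ≠ 1) (hβ : β ≠ 1) :
    Function.Injective fun m : ℕ => (of β * of α : CoprodI M) ^ m := by
  rw [injective_pow_iff_not_isOfFinOrder, isOfFinOrder_iff_pow_eq_one]
  rintro ⟨m, hm, h⟩
  obtain ⟨k, rfl⟩ := Nat.exists_eq_succ_of_ne_zero hm.ne'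
  obtain ⟨n, -, hn⟩ := exists_NeWord_pow hα hβ k
  exact NeWord_prod_ne_one n (hn.trans h)

theorem of_mul_pow_notMem_trunkDomain (hα : α ≠ 1) (hβ : β ≠ 1) {u : M true} (hu : u ≠ 1)
    (huα : u ≠ α) (m : ℕ) : of u * (of β * of α) ^ m ∉ trunkDomain α β false := by
  obtain ⟨n, rfl, hn⟩ := exists_NeWord_of_mul_pow hα hβ hu m
  rw [← hn]
  rintro ((⟨i, n', h⟩ | ⟨v, h⟩) | ⟨k, v, h⟩)
  · cases NeWord_last_idx_eq_of_prod_eq h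
  · by_cases hv : v = 1
    · exact NeWord_prod_ne_one n (by rw [← h, hv, map_one])
    · have := NeWord_head_eq_of_prod_eq ((NeWord.prod_singleton v hv).trans h)
      cases congrArg Sigma.fst this
  · by_cases hv : v = 1
    · obtain ⟨n', hn', h'⟩ := exists_NeWord_of_mul_pow hα hβ hα k
      rw [hv, map_one, one_mul, ← h'] at h
      have := NeWord_head_eq_of_prod_eq h
      rw [hn'] at this
      exact huα (by simpa using this)
    · obtain ⟨n', -, h'⟩ := exists_NeWord_of_mul_of_mul_pow hα hβ hv k
      have := NeWord_head_eq_of_prod_eq (h.trans h'.symm)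
      cases congrArg Sigma.fst this

theorem of_mul_of_mul_pow_notMem_trunkDomain (hα : α ≠ 1) (hβ : β ≠ 1) {u : M false} (hu : u ≠ 1)
    (huβ : u ≠ β) (m : ℕ) : of u * (of α * (of β * of α) ^ m) ∉ trunkDomain α β true := by
  obtain ⟨n, rfl, hn⟩ := exists_NeWord_of_mul_of_mul_pow hα hβ hu m
  rw [← hn]
  rintro (⟨i, n', h⟩ | ⟨k, v, h⟩)
  · cases NeWord_last_idx_eq_of_prod_eq h
  · by_cases hv : v = 1
    · cases k with
      | zero => exact NeWord_prod_ne_one n (by rw [h, hv, map_one, one_mul, pow_zero])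
      | succ k =>
        obtain ⟨n', hn', h'⟩ := exists_NeWord_pow hα hβ k
        rw [hv, map_one, one_mul, ← h'] at h
        have := NeWord_head_eq_of_prod_eq h
        rw [hn'] at this
        exact huβ (by simpa using this)
    · obtain ⟨n', -, h'⟩ := exists_NeWord_of_mul_pow hα hβ hv k
      have := NeWord_head_eq_of_prod_eq (h.trans h'.symm)
      cases congrArg Sigma.fst this

variable (α β) in
/-- The action of the free product of `M true` and `M false` on itself that is truncated to
`trunkDomain`. -/
noncomputable def trunkAction : CoprodI M →* Equiv.Perm (CoprodI M) :=
  truncatedMul (trunkDomain α β) (of_mul_mem_trunkDomain α β)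

theorem trunkAction_true_mem_trunk (hα : α ≠ 1) (hβ : β ≠ 1) {n : ℕ} {w : CoprodI M}
    (hw : w ∈ trunk α β n) (hwn : w ≠ (of β * of α) ^ n) (a : M true) :
    trunkAction α β (of a) w ∈ trunk α β n := by
  have key : ∀ m < n, ∀ u : M true,
      trunkAction α β (of a) (of u * (of β * of α) ^ m) ∈ trunk α β n := fun m hm u => by
    rw [trunkAction, truncatedMul_of_mem _ _ (Or.inr ⟨m, u, rfl⟩)]
    exact ⟨m, hm, Or.inl ⟨a * u, by rw [map_mul, mul_assoc]⟩⟩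
  obtain ⟨m, hm, ⟨u, rfl⟩ | ⟨u, rfl⟩⟩ := hw
  · exact key m hm u
  · by_cases hu : u = 1
    · simpa [hu] using key m hm α
    by_cases huβ : u = β
    · have h : of u * (of α * (of β * of α) ^ m) = (of β * of α : CoprodI M) ^ (m + 1) := by
        rw [huβ, pow_succ', mul_assoc]
      rw [h] at hwn ⊢
      have := key (m + 1) (lt_of_le_of_ne hm fun h => hwn (by rw [← h])) 1
      rwa [map_one, one_mul] at this
    · rw [trunkAction, truncatedMul_of_notMem _ _
        (of_mul_of_mul_pow_notMem_trunkDomain hα hβ hu huβ m)]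
      exact ⟨m, hm, Or.inr ⟨u, rfl⟩⟩

theorem trunkAction_false_mem_trunk (hα : α ≠ 1) (hβ : β ≠ 1) {n : ℕ} {w : CoprodI M}
    (hw : w ∈ trunk α β n) (hw1 : w ≠ 1) (b : M false) :
    trunkAction α β (of b) w ∈ trunk α β n := by
  have key : ∀ m < n, ∀ u : M false,
      trunkAction α β (of b) (of u * (of α * (of β * of α) ^ m)) ∈ trunk α β n := fun m hm u => by
    rw [trunkAction, truncatedMul_of_mem _ _ (Or.inr ⟨m, u, rfl⟩)]
    exact ⟨m, hm, Or.inr ⟨b * u, by rw [map_mul, mul_assoc]⟩⟩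
  obtain ⟨m, hm, ⟨u, rfl⟩ | ⟨u, rfl⟩⟩ := hw
  · by_cases hu : u = 1
    · cases m with
      | zero => simp [hu] at hw1
      | succ m =>
        have := key m (by lia) β
        rwa [← mul_assoc, ← pow_succ', ← one_mul ((of β * of α) ^ (m + 1)), ← map_one of,
          ← hu] at this
    by_cases huα : u = α
    · simpa [huα] using key m hm 1
    · rw [trunkAction, truncatedMul_of_notMem _ _
        (of_mul_pow_notMem_trunkDomain hα hβ hu huα m)]
      exact ⟨m, hm, Or.inl ⟨u, rfl⟩⟩
  · exact key m hm u

theorem trunkAction_pow_one (m : ℕ) :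
    trunkAction α β ((of β * of α) ^ m) 1 = (of β * of α) ^ m := by
  induction m with
  | zero => simp
  | succ m ih =>
    rw [pow_succ', map_mul, Equiv.Perm.mul_apply, ih, map_mul, Equiv.Perm.mul_apply, trunkAction,
      truncatedMul_of_mem _ α (Or.inr ⟨m, 1, by simp⟩),
      truncatedMul_of_mem _ β (Or.inr ⟨m, 1, by simp⟩), mul_assoc]

theorem trunkAction_of_false_one (b : M false) : trunkAction α β (of b) 1 = of b := by
  rw [trunkAction, truncatedMul_of_mem _ b (Or.inl (Or.inr ⟨1, map_one _⟩)), mul_one]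

/-- The restriction of `trunkAction` to the orbit of `1` is faithful. -/
theorem eq_one_of_trunkAction_eq (hα : α ≠ 1) (hβ : β ≠ 1) {w : CoprodI M}
    (h₁ : trunkAction α β w (trunkAction α β (of β) 1) = trunkAction α β (of β) 1)
    (h₂ : trunkAction α β w (trunkAction α β (of α * of β) 1) =
      trunkAction α β (of α * of β) 1) : w = 1 := by
  by_contra hne
  obtain ⟨i, j, n, rfl⟩ := exists_NeWord_prod_eq hne
  suffices ∃ k, j ≠ k ∧ ∃ v : NeWord M k false, trunkAction α β v.prod 1 = v.prod ∧
      trunkAction α β n.prod (trunkAction α β v.prod 1) = trunkAction α β v.prod 1 by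
    obtain ⟨k, hjk, v, hv, this⟩ := this
    rw [hv, trunkAction, truncatedMul_prod _ (endsIn_subset_trunkDomain α β) n v hjk] at this
    exact hne (by simpa using this)
  let v : NeWord M false false := .singleton β hβ
  have hv : trunkAction α β v.prod 1 = v.prod := by
    rw [NeWord.prod_singleton, trunkAction_of_false_one]
  cases j
  · refine ⟨true, by simp, (NeWord.singleton α hα).append (by simp) v, ?_, by
      rwa [NeWord.append_prod, NeWord.prod_singleton, NeWord.prod_singleton]⟩
    rw [NeWord.append_prod, map_mul, Equiv.Perm.mul_apply, hv, trunkAction,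
      truncatedMul_prod _ (endsIn_subset_trunkDomain α β) _ v (by simp)]
  · exact ⟨false, by simp, v, hv, by rwa [NeWord.prod_singleton]⟩

theorem finite_trunk [∀ i, Finite (M i)] (n : ℕ) :
    (trunk α β n).Finite ∧
      (trunk α β n).ncard ≤ n * (Nat.card (M true) + Nat.card (M false)) := by
  let f : Fin n × (M true ⊕ M false) → CoprodI M := fun x =>
    x.2.elim (fun u => of u * (of β * of α) ^ (x.1 : ℕ))
      fun u => of u * (of α * (of β * of α) ^ (x.1 : ℕ))
  have hf : trunk α β n = Set.range f := by
    ext w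
    constructor
    · rintro ⟨m, hm, ⟨u, rfl⟩ | ⟨u, rfl⟩⟩
      · exact ⟨(⟨m, hm⟩, Sum.inl u), rfl⟩
      · exact ⟨(⟨m, hm⟩, Sum.inr u), rfl⟩
    · rintro ⟨⟨m, u | u⟩, rfl⟩
      · exact ⟨m, m.2, Or.inl ⟨u, rfl⟩⟩
      · exact ⟨m, m.2, Or.inr ⟨u, rfl⟩⟩
  rw [hf]
  refine ⟨Set.finite_range f, ?_⟩
  rw [← Set.image_univ]
  refine (Set.ncard_image_le Set.finite_univ).trans ?_
  rw [Set.ncard_univ, Nat.card_prod, Nat.card_sum, Nat.card_fin]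

end Trunk

section TorusKnot

open Monoid CoprodI

theorem exists_hom_zmod {H : Type*} [Group H] (n : ℕ) (h : H) (hn : h ^ n = 1) :
    ∃ f : Multiplicative (ZMod n) →* H, f (.ofAdd 1) = h := by
  let f : ZMod n →+ Additive H := ZMod.lift n ⟨zmultiplesHom (Additive H) (.ofMul h), by
    simp only [zmultiplesHom_apply, natCast_zsmul]
    exact congrArg Additive.ofMul hn⟩
  refine ⟨AddMonoidHom.toMultiplicativeLeft f, ?_⟩
  change (f 1).toMul = h
  have : f ((1 : ℤ) : ZMod n) = .ofMul h := by
    rw [ZMod.lift_coe]; simp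
  rw [← Int.cast_one, this]
  rfl

/-- The cyclic factors of the quotient of the torus knot group by its center. -/
abbrev TorusKnotFactor (p q : ℕ) (i : Bool) : Type :=
  Multiplicative (ZMod (bif i then p else q))

/-- The torus knot group as a presented group. -/
abbrev TorusKnotPresentation (p q : ℕ) : Type :=
  PresentedGroup ({FreeGroup.of true ^ p * (FreeGroup.of false ^ q)⁻¹} : Set (FreeGroup Bool))

namespace TorusKnotPresentation

variable {p q : ℕ}

theorem of_pow_eq : (PresentedGroup.of true : TorusKnotPresentation p q) ^ p =
    PresentedGroup.of false ^ q := by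
  have h : PresentedGroup.mk ({FreeGroup.of true ^ p * (FreeGroup.of false ^ q)⁻¹} :
      Set (FreeGroup Bool)) (FreeGroup.of true ^ p * (FreeGroup.of false ^ q)⁻¹) = 1 :=
    PresentedGroup.one_of_mem (Set.mem_singleton _)
  rw [map_mul, map_inv, map_pow, map_pow] at h
  exact mul_inv_eq_one.1 h

variable (p q)

theorem exists_hom {H : Type*} [Group H] (x y : H) (h : x ^ p = y ^ q) :
    ∃ f : TorusKnotPresentation p q →* H,
      f (PresentedGroup.of true) = x ∧ f (PresentedGroup.of false) = y := by
  refine ⟨PresentedGroup.toGroup (f := fun i => bif i then x else y) ?_, ?_, ?_⟩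
  · rintro _ rfl
    simp [h]
  · simp
  · simp

theorem of_pow_mem_center : (PresentedGroup.of true : TorusKnotPresentation p q) ^ p ∈
    Subgroup.center (TorusKnotPresentation p q) := by
  rw [Subgroup.mem_center_iff]
  intro g
  refine PresentedGroup.generated_by _ (Subgroup.centralizer {PresentedGroup.of true ^ p})
    (fun i => ?_) g _ rfl |>.symm
  rintro _ rfl
  cases i
  · rw [of_pow_eq]
    exact (Commute.refl _).pow_left q
  · exact (Commute.refl _).pow_left p

theorem exists_homs : ∃ (ψ : TorusKnotPresentation p q →* CoprodI (TorusKnotFactor p q))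
    (ℓ : TorusKnotPresentation p q →* Multiplicative ℤ),
    (∀ i, ψ (PresentedGroup.of i) = of (M := TorusKnotFactor p q) (i := i) (.ofAdd 1)) ∧
    ℓ (PresentedGroup.of true) = .ofAdd (q : ℤ) ∧ ℓ (PresentedGroup.of false) = .ofAdd (p : ℤ) ∧
    ∀ g, ψ g = 1 → ∃ k : ℤ, g = (PresentedGroup.of true ^ p) ^ k := by
  have hpow : ∀ i, (of (M := TorusKnotFactor p q) (i := i) (.ofAdd 1)) ^
      (bif i then p else q) = 1 := fun i => by
    rw [← map_pow, ← ofAdd_nsmul]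
    simp
  obtain ⟨ψ, hψ1, hψ2⟩ := exists_hom p q _ _ ((hpow true).trans (hpow false).symm)
  obtain ⟨ℓ, hℓ1, hℓ2⟩ := exists_hom p q (.ofAdd (q : ℤ) : Multiplicative ℤ) (.ofAdd (p : ℤ)) (by
    rw [← ofAdd_nsmul, ← ofAdd_nsmul]; simp [mul_comm])
  refine ⟨ψ, ℓ, by rintro (_ | _) <;> assumption, hℓ1, hℓ2, fun g hg => ?_⟩
  let N : Subgroup (TorusKnotPresentation p q) := Subgroup.zpowers (PresentedGroup.of true ^ p)
  have hN : N ≤ Subgroup.center _ := by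
    rw [Subgroup.zpowers_le]; exact of_pow_mem_center p q
  have : N.Normal := ⟨fun n hn g => by
    rwa [(Subgroup.mem_center_iff.1 (hN hn) g), mul_inv_cancel_right]⟩
  have hz : ∀ i, (QuotientGroup.mk' N (PresentedGroup.of i)) ^ (bif i then p else q) = 1 := by
    intro i
    rw [← map_pow, QuotientGroup.mk'_apply, QuotientGroup.eq_one_iff]
    cases i
    · simp only [cond_false]
      rw [← of_pow_eq]
      exact Subgroup.mem_zpowers _
    · exact Subgroup.mem_zpowers _
  choose f hf using fun i => exists_hom_zmod _ _ (hz i)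
  have hcomp : (lift f).comp ψ = QuotientGroup.mk' N := by
    refine PresentedGroup.ext fun i => ?_
    cases i
    · rw [MonoidHom.comp_apply, hψ2, lift_of, hf]
    · rw [MonoidHom.comp_apply, hψ1, lift_of, hf]
  have hgN : g ∈ N := by
    rw [← QuotientGroup.eq_one_iff, ← QuotientGroup.mk'_apply, ← hcomp, MonoidHom.comp_apply, hg,
      map_one]
  obtain ⟨k, hk⟩ := Subgroup.mem_zpowers_iff.1 hgN
  exact ⟨k, hk.symm⟩

open Filter Topology in
theorem tendsto_div_zero_of_le_mul {a b : ℕ → ℕ} (C : ℕ) (ha : ∀ n, a n ≤ C * n)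
    (hb : ∀ n, n * n ≤ b n) :
    Tendsto (fun n => (a n : ℝ) / (b n : ℝ)) atTop (𝓝 0) := by
  refine squeeze_zero' (Eventually.of_forall fun n => by positivity) ?_
    (tendsto_const_div_atTop_nhds_zero_nat (C : ℝ))
  filter_upwards [eventually_gt_atTop 0] with n hn
  have h1 : (a n : ℝ) ≤ C * n := by exact_mod_cast ha n
  have h2 : (n * n : ℝ) ≤ b n := by exact_mod_cast hb n
  have hn' : (0 : ℝ) < n := by exact_mod_cast hn
  rw [div_le_div_iff₀ (lt_of_lt_of_le (by positivity) h2) hn']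
  have hC : (0 : ℝ) ≤ C := by positivity
  nlinarith

/-- A skew translation of `X × ℤ` moves few points of `T × [0, N)` outside of `T × [0, N)`. -/
theorem ncard_boundary_le {X : Type*} {T : Set X} (hT : T.Finite) (N c : ℕ) (σ : X → X) (w : X)
    (hσ : ∀ x ∈ T, x ≠ w → σ x ∈ T) :
    {e ∈ T ×ˢ Set.Ico (0 : ℤ) N | (σ e.1, e.2 + c) ∉ T ×ˢ Set.Ico (0 : ℤ) N}.ncard ≤
      N + T.ncard * c := by
  have hsub : {e ∈ T ×ˢ Set.Ico (0 : ℤ) N | (σ e.1, e.2 + c) ∉ T ×ˢ Set.Ico (0 : ℤ) N} ⊆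
      {w} ×ˢ Set.Ico (0 : ℤ) N ∪ T ×ˢ Set.Ico ((N : ℤ) - c) N := by
    rintro ⟨x, k⟩ ⟨⟨hx, hk0, hkN⟩, hxk⟩
    by_cases hxw : x = w
    · exact Or.inl ⟨hxw, hk0, hkN⟩
    · refine Or.inr ⟨hx, ?_, hkN⟩
      by_contra hlt
      simp only at hk0 hkN hlt
      exact hxk ⟨hσ x hx hxw, by simp only; lia, by simp only; lia⟩
  refine (Set.ncard_le_ncard hsub (((Set.finite_singleton w).prod (Set.finite_Ico _ _)).union
    (hT.prod (Set.finite_Ico _ _)))).trans ((Set.ncard_union_le _ _).trans ?_)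
  simp [Set.ncard_prod, Set.ncard_eq_toFinset_card']

theorem inClassA (hp : 2 ≤ p) (hq : 2 ≤ q) : InClassA (TorusKnotPresentation p q) := by
  obtain ⟨ψ, ℓ, hψ, hℓ1, hℓ2, hker⟩ := exists_homs p q
  have : Fact (1 < p) := ⟨hp⟩
  have : Countable (TorusKnotPresentation p q) := (PresentedGroup.mk_surjective _).countable
  have : Fact (1 < q) := ⟨hq⟩
  have : ∀ i, Finite (TorusKnotFactor p q i) := by
    have : NeZero p := ⟨by lia⟩
    have : NeZero q := ⟨by lia⟩
    rintro (_ | _)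
    · exact inferInstanceAs (Finite (ZMod q))
    · exact inferInstanceAs (Finite (ZMod p))
  let α : TorusKnotFactor p q true := .ofAdd (1 : ZMod p)
  let β : TorusKnotFactor p q false := .ofAdd (1 : ZMod q)
  have hα : α ≠ 1 := fun h => one_ne_zero (α := ZMod p) (congrArg Multiplicative.toAdd h)
  have hβ : β ≠ 1 := fun h => one_ne_zero (α := ZMod q) (congrArg Multiplicative.toAdd h)
  have hψ1 : ψ (PresentedGroup.of true) = of α := hψ true
  have hψ2 : ψ (PresentedGroup.of false) = of β := hψ false
  let φ : TorusKnotPresentation p q →* Equiv.Perm (CoprodI (TorusKnotFactor p q) × ℤ) :=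
    MonoidHom.mk' (fun g =>
      (trunkAction α β (ψ g)).prodCongr (Equiv.addRight (ℓ g).toAdd)) fun g h => by
        ext ⟨w, k⟩ <;> simp [add_comm, add_left_comm]
  have hφ : ∀ g w k, φ g (w, k) = (trunkAction α β (ψ g) w, k + (ℓ g).toAdd) :=
    fun _ _ _ => rfl
  let z : TorusKnotPresentation p q := PresentedGroup.of true ^ p
  have hψz : ψ z = 1 := by
    rw [map_pow, hψ1, ← map_pow]
    change of (M := TorusKnotFactor p q) (i := true) (.ofAdd (p • (1 : ZMod p))) = 1
    simp
  have hℓz : ∀ k : ℤ, (ℓ (z ^ k)).toAdd = k * (p * q) := fun k => by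
    simp [z, hℓ1]
  let O : Set (CoprodI (TorusKnotFactor p q) × ℤ) := Set.range fun g => φ g (1, 0)
  have hO : ∀ g e, e ∈ O → φ g e ∈ O := by
    rintro g _ ⟨h, rfl⟩
    exact ⟨g * h, by simp⟩
  let B : ℕ → Set (CoprodI (TorusKnotFactor p q) × ℤ) := fun n =>
    trunk α β n ×ˢ Set.Ico (0 : ℤ) (n * (p * q) : ℕ)
  have hBfin : ∀ n, (B n).Finite := fun n => (finite_trunk n).1.prod (Set.finite_Ico _ _)
  have hcard : ∀ n, n * n ≤ (B n ∩ O).ncard := fun n => by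
    let r : ℕ → ℕ → ℤ := fun m k => (m * (p + q) : ℤ) % (p * q) + p * q * k
    let f : Fin n × Fin n → CoprodI (TorusKnotFactor p q) × ℤ := fun x =>
      ((of β * of α) ^ (x.1 : ℕ), r x.1 x.2)
    have hpq : (0 : ℤ) < p * q := by positivity
    have hf : Function.Injective f := by
      rintro ⟨m, k⟩ ⟨m', k'⟩ h
      have h1 : m = m' := Fin.ext (pow_mul_injective hα hβ (congrArg Prod.fst h))
      subst h1
      have h2 : r m k = r m k' := congrArg Prod.snd h
      have h3 : (p * q : ℤ) * k = p * q * k' := by simpa [r] using h2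
      have h4 := mul_left_cancel₀ hpq.ne' h3
      rw [Nat.cast_inj] at h4
      rw [Fin.ext h4]
    have hrange : Set.range f ⊆ B n ∩ O := by
      rintro _ ⟨⟨m, k⟩, rfl⟩
      refine ⟨⟨⟨m, m.2, Or.inl ⟨1, by simp [f]⟩⟩, ?_, ?_⟩, ?_⟩
      · have := Int.emod_nonneg (m * (p + q) : ℤ) hpq.ne'
        change 0 ≤ r m k
        positivity
      · have h1 := Int.emod_lt_of_pos (m * (p + q) : ℤ) hpq
        have h2 : (k + 1 : ℤ) ≤ n := by exact_mod_cast k.2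
        change r m k < _
        simp only [r]
        push_cast
        nlinarith
      · refine ⟨z ^ ((k : ℤ) - (m * (p + q) : ℤ) / (p * q)) *
          (PresentedGroup.of false * PresentedGroup.of true) ^ (m : ℕ), ?_⟩
        refine (hφ _ _ _).trans (Prod.ext ?_ ?_)
        · change trunkAction α β (ψ _) 1 = (of β * of α) ^ (m : ℕ)
          rw [map_mul, map_zpow, hψz, one_zpow, one_mul, map_pow, map_mul, hψ1, hψ2,
            trunkAction_pow_one]
        · have := Int.emod_add_mul_ediv (m * (p + q) : ℤ) (p * q)
          change 0 + (ℓ _).toAdd = r m k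
          rw [map_mul, toAdd_mul, hℓz, map_pow, map_mul, hℓ1, hℓ2]
          simp only [r, toAdd_pow, toAdd_mul, toAdd_ofAdd, nsmul_eq_mul]
          linarith
    calc n * n = (Set.range f).ncard := by
          rw [← Set.image_univ, Set.ncard_image_of_injective _ hf]; simp
      _ ≤ _ := Set.ncard_le_ncard hrange ((hBfin n).inter_of_left _)
  have hbd : ∀ (i : Bool) (c : ℕ), (ℓ (PresentedGroup.of i)).toAdd = c →
      (∀ n, ∃ w, ∀ x ∈ trunk α β n, x ≠ w →
        trunkAction α β (ψ (PresentedGroup.of i)) x ∈ trunk α β n) → ∀ n,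
      {e ∈ B n ∩ O | φ (PresentedGroup.of i) e ∉ B n ∩ O}.ncard ≤
        (p * q + (Nat.card (TorusKnotFactor p q true) + Nat.card (TorusKnotFactor p q false)) * c)
          * n := fun i c hc h n => by
    obtain ⟨w, hw⟩ := h n
    have h1 := ncard_boundary_le (finite_trunk n).1 (n * (p * q)) c _ w hw
    have h2 : {e ∈ B n ∩ O | φ (PresentedGroup.of i) e ∉ B n ∩ O} ⊆
        {e ∈ B n | (trunkAction α β (ψ (PresentedGroup.of i)) e.1, e.2 + (c : ℤ)) ∉ B n} := by
      rintro ⟨x, k⟩ ⟨⟨heB, heO⟩, he⟩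
      refine ⟨heB, fun h => he ⟨?_, hO _ _ heO⟩⟩
      rwa [hφ, hc]
    have h3 := Set.ncard_le_ncard h2 ((hBfin n).subset (Set.sep_subset _ _))
    refine (h3.trans h1).trans ?_
    have h4 := Nat.mul_le_mul_right c (finite_trunk (α := α) (β := β) n).2
    nlinarith
  refine inClassA_of_orbit φ (1, 0) ?_ (PresentedGroup.closure_range_of _) (fun n => B n ∩ O)
    (fun n => (hBfin n).inter_of_left _) ?_ (fun n => Set.inter_subset_right) ?_
  · intro g hg
    have hψg : ψ g = 1 := by
      have h₁ := congrArg Prod.fst (hg (PresentedGroup.of false))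
      have h₂ := congrArg Prod.fst (hg (PresentedGroup.of true * PresentedGroup.of false))
      simp only [hφ, map_mul ψ, hψ1, hψ2] at h₁ h₂
      exact eq_one_of_trunkAction_eq hα hβ h₁ h₂
    obtain ⟨k, rfl⟩ := hker g hψg
    have h0 := congrArg Prod.snd (hg 1)
    rw [map_one, Equiv.Perm.one_apply, hφ, hℓz] at h0
    have hk : k = 0 := by
      have : (p * q : ℤ) ≠ 0 := by positivity
      simpa [this] using h0
    rw [hk, zpow_zero]
  · filter_upwards [Filter.eventually_gt_atTop 0] with n hn
    rw [← Set.ncard_pos ((hBfin n).inter_of_left _)]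
    exact (Nat.mul_pos hn hn).trans_le (hcard n)
  · rintro _ ⟨i, rfl⟩
    cases i
    · exact tendsto_div_zero_of_le_mul _ (hbd false p (by rw [hℓ2]; rfl) fun n =>
        ⟨1, fun x hx hx1 => by
          rw [hψ2]; exact trunkAction_false_mem_trunk hα hβ hx hx1 β⟩) hcard
    · exact tendsto_div_zero_of_le_mul _ (hbd true q (by rw [hℓ1]; rfl) fun n =>
        ⟨(of β * of α) ^ n, fun x hx hxn => by
          rw [hψ1]; exact trunkAction_true_mem_trunk hα hβ hx hxn α⟩) hcard

end TorusKnotPresentation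

end TorusKnot

/-- Example 2.14 (Moon, arXiv:1003.3998).
For all `p, q ≥ 2`, the torus knot group `Γ_{p,q} = ⟨x, y | xᵖ = y^q⟩` is in the
class `𝒜`. -/
theorem torusKnotGroup_mem_classA (p q : ℕ) (hp : 2 ≤ p) (hq : 2 ≤ q) :
    InClassA (TorusKnotGroup p q) := by
  exact TorusKnotPresentation.inClassA p q hp hq
end

section
/- Let G be an infinite finitely generated group of polynomial growth and let {a_n}_{n≥1} be a strictly ascending sequence of positive integers. Then G has a Følner sequence {F_n}_{n≥1} such that |F_n| = a_n for all n ≥ 1. -/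
/-- A Følner sequence for the action of `G` on `X` given by `φ`: a sequence of finite
non-empty subsets `C n` of `X` with `|C n △ g • C n| / |C n| → 0` for every `g : G`. -/
def IsFolnerSeq {G X : Type*} [Group G] (φ : G →* Equiv.Perm X) (C : ℕ → Set X) : Prop :=
  (∀ n, (C n).Finite ∧ (C n).Nonempty) ∧
  ∀ g : G, Filter.Tendsto
    (fun n => ((symmDiff (C n) ((φ g) '' C n)).ncard : ℝ) / ((C n).ncard : ℝ))
    Filter.atTop (nhds 0)

/-- The ball of radius `k` centered at the identity in the Cayley graph of `G` with
respect to the generating set `S`: all products of at most `k` elements of `S`. -/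
def wordBall {G : Type*} [Group G] (S : Finset G) (k : ℕ) : Set G :=
  {g | ∃ l : List G, (∀ x ∈ l, x ∈ S) ∧ l.length ≤ k ∧ l.prod = g}

open Classical in
/-- The points of `F` that left translation by `g` moves out of `F`. -/
noncomputable def escapeSet {G : Type*} [Group G] (g : G) (F : Finset G) : Finset G :=
  F.filter (fun x => g * x ∉ F)

section Growth

variable {G : Type*} [Group G] {S : Finset G}

theorem wordBall_finite (S : Finset G) (k : ℕ) : (wordBall S k).Finite := by
  refine ((List.finite_length_le S k).image
    (fun l : List S => (l.map Subtype.val).prod)).subset ?_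
  rintro g ⟨l, hl, hk, rfl⟩
  refine ⟨l.attach.map (fun x => ⟨x.1, hl x.1 x.2⟩), by simpa using hk, ?_⟩
  simp [List.map_map, Function.comp_def]

theorem wordBall_mono {k m : ℕ} (h : k ≤ m) : wordBall S k ⊆ wordBall S m := by
  rintro g ⟨l, hl, hk, rfl⟩
  exact ⟨l, hl, hk.trans h, rfl⟩

theorem wordBall_zero : wordBall S 0 = {1} := by
  ext g
  constructor
  · rintro ⟨l, -, hk, rfl⟩
    rw [List.length_eq_zero_iff.1 (Nat.le_zero.1 hk)]
    rfl
  · rintro rfl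
    exact ⟨[], by simp, le_rfl, rfl⟩

theorem mul_mem_wordBall {g h : G} {k m : ℕ} (hg : g ∈ wordBall S k) (hh : h ∈ wordBall S m) :
    g * h ∈ wordBall S (m + k) := by
  obtain ⟨l, hl, hk, rfl⟩ := hg
  obtain ⟨l', hl', hk', rfl⟩ := hh
  refine ⟨l ++ l', fun x hx => ?_, by simp; omega, by simp⟩
  rcases List.mem_append.1 hx with h | h
  exacts [hl x h, hl' x h]

theorem exists_mem_wordBall (hS : ∀ s ∈ S, s⁻¹ ∈ S)
    (hgen : Subgroup.closure (S : Set G) = ⊤) (g : G) : ∃ k, g ∈ wordBall S k := by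
  have hsymm : (S : Set G) ∪ (S : Set G)⁻¹ = S :=
    Set.union_eq_left.2 fun s hs => by simpa using hS _ hs
  have hg : g ∈ Submonoid.closure (S : Set G) := by
    rw [← hsymm, ← Subgroup.closure_toSubmonoid, hgen]
    trivial
  obtain ⟨l, hl, rfl⟩ := Submonoid.exists_list_of_mem_closure hg
  exact ⟨l.length, l, hl, le_rfl, rfl⟩

theorem exists_ncard_wordBall_add_le {c : ℝ} {d : ℕ}
    (hpoly : ∀ k : ℕ, 1 ≤ k → ((wordBall S k).ncard : ℝ) ≤ c * (k : ℝ) ^ d)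
    {r : ℕ} (hr : 1 ≤ r) {ε : ℝ} (hε : 0 < ε) :
    ∃ k, ((wordBall S (k + r)).ncard : ℝ) ≤ (1 + ε) * (wordBall S k).ncard := by
  by_contra! h
  have hexp : ∀ n : ℕ, (1 + ε) ^ n ≤ ((wordBall S (n * r)).ncard : ℝ) := by
    intro n
    induction n with
    | zero => simp [wordBall_zero]
    | succ n ih =>
      rw [pow_succ', Nat.succ_mul]
      exact (mul_le_mul_of_nonneg_left ih (by positivity)).trans (h _).le
  have hlim := (tendsto_pow_const_div_const_pow_of_one_lt d
    (show 1 < 1 + ε by linarith)).const_mul (c * (r : ℝ) ^ d)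
  rw [mul_zero] at hlim
  obtain ⟨n, hn, hn1⟩ := ((hlim.eventually (gt_mem_nhds one_pos)).and
    (Filter.eventually_ge_atTop 1)).exists
  have hle := (hexp n).trans (hpoly (n * r) (Nat.mul_pos hn1 hr))
  rw [← mul_div_assoc, div_lt_one (by positivity)] at hn
  rw [Nat.cast_mul, mul_pow] at hle
  linarith

/-- Polynomial growth yields finite sets almost invariant under a ball. -/
theorem exists_card_escapeSet_le {c : ℝ} {d : ℕ}
    (hpoly : ∀ k : ℕ, 1 ≤ k → ((wordBall S k).ncard : ℝ) ≤ c * (k : ℝ) ^ d)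
    (r : ℕ) {ε : ℝ} (hε : 0 < ε) :
    ∃ E : Finset G, E.Nonempty ∧
      ∀ g ∈ wordBall S r, ((escapeSet g E).card : ℝ) ≤ ε * E.card := by
  classical
  obtain ⟨k, hk⟩ := exists_ncard_wordBall_add_le hpoly (Nat.le_add_left 1 r) hε
  refine ⟨(wordBall_finite S k).toFinset, ⟨1, ?_⟩, fun g hg => ?_⟩
  · rw [Set.Finite.mem_toFinset]
    exact ⟨[], by simp, Nat.zero_le _, rfl⟩
  set E := (wordBall_finite S k).toFinset with hE
  set B := (wordBall_finite S (k + (r + 1))).toFinset with hB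
  rw [Set.ncard_eq_toFinset_card _ (wordBall_finite S k),
    Set.ncard_eq_toFinset_card _ (wordBall_finite S _), ← hE, ← hB] at hk
  have hEB : E ⊆ B := Set.Finite.toFinset_subset_toFinset.2 (wordBall_mono (by omega))
  have hcard : (escapeSet g E).card ≤ (B \ E).card := by
    refine Finset.card_le_card_of_injOn (g * ·) (fun x hx => ?_)
      (mul_right_injective g).injOn
    obtain ⟨hx, hgx⟩ := Finset.mem_filter.1 hx
    refine Finset.mem_coe.2 (Finset.mem_sdiff.2 ⟨?_, hgx⟩)
    rw [hB, Set.Finite.mem_toFinset]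
    rw [hE, Set.Finite.mem_toFinset] at hx
    exact wordBall_mono (by omega) (mul_mem_wordBall hg hx)
  have hsum : ((B \ E).card : ℝ) + E.card = B.card := by
    exact_mod_cast Finset.card_sdiff_add_card_eq_card hEB
  have : ((escapeSet g E).card : ℝ) ≤ (B \ E).card := by exact_mod_cast hcard
  linarith

end Growth

section Tiling

variable {G : Type*} [Group G] [Infinite G]

theorem exists_disjoint_right_translate (E F : Finset G) :
    ∃ h : G, Disjoint F (E.map (mulRightEmbedding h)) := by
  classical
  obtain ⟨h, hh⟩ := Infinite.exists_notMem_finset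
    (Finset.image₂ (fun x y => x⁻¹ * y) E F)
  refine ⟨h, Finset.disjoint_left.2 fun y hy hyE => hh ?_⟩
  obtain ⟨x, hx, rfl⟩ := Finset.mem_map.1 hyE
  exact Finset.mem_image₂.2 ⟨x, hx, _, hy, by simp⟩

/-- A union of `q` pairwise disjoint right translates of `E`. -/
theorem exists_card_eq_mul_and_escapeSet_le (E : Finset G) (q : ℕ) :
    ∃ F : Finset G, F.card = q * E.card ∧
      ∀ g, (escapeSet g F).card ≤ q * (escapeSet g E).card := by
  classical
  induction q with
  | zero => exact ⟨∅, by simp, by simp [escapeSet]⟩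
  | succ q ih =>
    obtain ⟨F, hF, hesc⟩ := ih
    obtain ⟨h, hh⟩ := exists_disjoint_right_translate E F
    refine ⟨F ∪ E.map (mulRightEmbedding h), ?_, fun g => ?_⟩
    · rw [Finset.card_union_of_disjoint hh, hF, Finset.card_map, Nat.succ_mul]
    · have hsub : escapeSet g (F ∪ E.map (mulRightEmbedding h)) ⊆
          escapeSet g F ∪ (escapeSet g E).map (mulRightEmbedding h) := by
        intro x hx
        obtain ⟨hx, hgx⟩ := Finset.mem_filter.1 hx
        rw [Finset.mem_union, not_or] at hgx
        rcases Finset.mem_union.1 hx with hx | hx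
        · exact Finset.mem_union_left _ (Finset.mem_filter.2 ⟨hx, hgx.1⟩)
        · obtain ⟨y, hy, rfl⟩ := Finset.mem_map.1 hx
          refine Finset.mem_union_right _ (Finset.mem_map_of_mem _
            (Finset.mem_filter.2 ⟨hy, fun hgy => hgx.2 ?_⟩))
          exact Finset.mem_map.2 ⟨g * y, hgy, mul_assoc _ _ _⟩
      calc _ ≤ _ := (Finset.card_le_card hsub).trans (Finset.card_union_le _ _)
        _ ≤ q * (escapeSet g E).card + (escapeSet g E).card := by
          rw [Finset.card_map]
          exact Nat.add_le_add_right (hesc g) _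
        _ = _ := (Nat.succ_mul _ _).symm

theorem exists_superset_card_eq_and_escapeSet_le (F : Finset G) (r : ℕ) :
    ∃ F' : Finset G, F'.card = F.card + r ∧
      ∀ g, (escapeSet g F').card ≤ (escapeSet g F).card + r := by
  classical
  obtain ⟨F', hsub, hcard⟩ := Infinite.exists_superset_card_eq F (F.card + r) (by omega)
  refine ⟨F', hcard, fun g => ?_⟩
  have hesc : escapeSet g F' ⊆ escapeSet g F ∪ (F' \ F) := by
    intro x hx
    obtain ⟨hx, hgx⟩ := Finset.mem_filter.1 hx
    by_cases hxF : x ∈ F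
    · exact Finset.mem_union_left _ (Finset.mem_filter.2 ⟨hxF, fun h => hgx (hsub h)⟩)
    · exact Finset.mem_union_right _ (Finset.mem_sdiff.2 ⟨hx, hxF⟩)
  have := (Finset.card_le_card hesc).trans (Finset.card_union_le _ _)
  have := Finset.card_sdiff_add_card_eq_card hsub
  omega

/-- In an infinite group, one almost invariant finite set gives almost invariant sets of every
large enough cardinality. -/
theorem exists_card_eq_and_escapeSet_le {K : Set G} {ε : ℝ} (hε : 0 < ε) {E : Finset G}
    (hE : E.Nonempty) (hEK : ∀ g ∈ K, ((escapeSet g E).card : ℝ) ≤ ε / 2 * E.card) :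
    ∃ N : ℕ, ∀ m ≥ N, ∃ F : Finset G, F.card = m ∧
      ∀ g ∈ K, ((escapeSet g F).card : ℝ) ≤ ε * F.card := by
  obtain ⟨N, hN⟩ := exists_nat_ge (E.card / (ε / 2) : ℝ)
  refine ⟨N, fun m hm => ?_⟩
  obtain ⟨F₀, hF₀, hesc₀⟩ := exists_card_eq_mul_and_escapeSet_le E (m / E.card)
  obtain ⟨F, hF, hesc⟩ := exists_superset_card_eq_and_escapeSet_le F₀ (m % E.card)
  have hFm : F.card = m := by rw [hF, hF₀, Nat.div_add_mod']
  refine ⟨F, hFm, fun g hg => ?_⟩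
  have hcard : ((escapeSet g F).card : ℝ) ≤
      (m / E.card : ℕ) * (escapeSet g E).card + (m % E.card : ℕ) := by
    exact_mod_cast (hesc g).trans (Nat.add_le_add_right (hesc₀ g) _)
  have hquot : ((m / E.card : ℕ) : ℝ) * E.card ≤ m := by
    exact_mod_cast Nat.div_mul_le_self m E.card
  have hrem : ((m % E.card : ℕ) : ℝ) ≤ E.card := by
    exact_mod_cast (Nat.mod_lt m hE.card_pos).le
  have hEm : (E.card : ℝ) ≤ m * (ε / 2) := by
    rw [← div_le_iff₀ (by positivity)]
    exact hN.trans (by exact_mod_cast hm)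
  have hmul := mul_le_mul_of_nonneg_left (hEK g hg) (Nat.cast_nonneg (α := ℝ) (m / E.card))
  have hmul' := mul_le_mul_of_nonneg_left hquot (show 0 ≤ ε / 2 by positivity)
  rw [hFm]
  linarith

end Tiling

theorem ncard_symmDiff_image_eq {G : Type*} [Group G] (g : G) (F : Finset G) :
    (symmDiff (F : Set G) ((MulAction.toPermHom G G g) '' F)).ncard =
      2 * (escapeSet g F).card := by
  classical
  have himage : (MulAction.toPermHom G G g) '' F = ((F.image (g * ·) : Finset G) : Set G) := by
    ext x
    simp [MulAction.toPermHom_apply, MulAction.toPerm_apply]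
  have hcard : (F.image (g * ·)).card = F.card :=
    Finset.card_image_of_injective _ (mul_right_injective g)
  have hesc : F.image (g * ·) \ F = (escapeSet g F).image (g * ·) := by
    ext x
    simp only [escapeSet, Finset.mem_sdiff, Finset.mem_image, Finset.mem_filter]
    constructor
    · rintro ⟨⟨y, hy, rfl⟩, h⟩
      exact ⟨y, ⟨hy, h⟩, rfl⟩
    · rintro ⟨y, ⟨hy, h⟩, rfl⟩
      exact ⟨⟨y, hy, rfl⟩, h⟩
  rw [himage, ← Finset.coe_symmDiff, Set.ncard_coe_finset, symmDiff_def, Finset.sup_eq_union,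
    Finset.card_union_of_disjoint disjoint_sdiff_sdiff, Finset.card_sdiff_comm hcard.symm, hesc,
    Finset.card_image_of_injective _ (mul_right_injective g), two_mul]

/-- If for each `j` all large `m` admit a set of cardinality `m` that is `1 / (j + 1)`-invariant
under the `j`-th member of a monotone family `K`, starting at `{1}`, then these sets can be chosen
for all `m` at once. -/
theorem exists_seq_card_eq_and_escapeSet_le {G : Type*} [Group G] [Infinite G] {K : ℕ → Set G}
    (hK : Monotone K) (hK0 : K 0 = {1})
    (h : ∀ j : ℕ, ∃ N : ℕ, ∀ m ≥ N, ∃ F : Finset G, F.card = m ∧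
      ∀ g ∈ K j, ((escapeSet g F).card : ℝ) ≤ 1 / ((j : ℝ) + 1) * F.card) :
    ∃ F : ℕ → Finset G, (∀ m, (F m).card = m) ∧
      ∀ j : ℕ, ∀ᶠ m in Filter.atTop, ∀ g ∈ K j,
        ((escapeSet g (F m)).card : ℝ) ≤ 1 / ((j : ℝ) + 1) * m := by
  classical
  let P (m j : ℕ) : Prop := ∃ F : Finset G, F.card = m ∧
      ∀ g ∈ K j, ((escapeSet g F).card : ℝ) ≤ 1 / ((j : ℝ) + 1) * F.card
  have hP0 (m : ℕ) : P m 0 := by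
    obtain ⟨F, -, hF⟩ := Infinite.exists_superset_card_eq (∅ : Finset G) m (by simp)
    refine ⟨F, hF, fun g hg => ?_⟩
    rw [hK0, Set.mem_singleton_iff] at hg
    have : escapeSet g F = ∅ := by simp [escapeSet, hg]
    rw [this, Finset.card_empty, Nat.cast_zero]
    positivity
  have hP (m : ℕ) : P m (Nat.findGreatest (P m) m) :=
    Nat.findGreatest_spec (Nat.zero_le m) (hP0 m)
  choose F hcard hF using hP
  refine ⟨F, hcard, fun j => ?_⟩
  obtain ⟨N, hN⟩ := h j
  filter_upwards [Filter.eventually_ge_atTop N, Filter.eventually_ge_atTop j] with m hmN hmj g hg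
  have hj : j ≤ Nat.findGreatest (P m) m := Nat.le_findGreatest hmj (hN m hmN)
  have hle := hF m g (hK hj hg)
  rw [hcard m] at hle
  refine hle.trans ?_
  gcongr

/-- Remark 2.12 (Moon, arXiv:1003.3998).
Let `G` be an infinite finitely generated group of polynomial growth (with respect to a
finite symmetric generating set `S`) and let `{a n}` be a strictly ascending sequence of
positive integers. Then `G` has a Følner sequence `{F n}` with `|F n| = a n` for all `n`. -/
theorem polynomial_growth_folner_of_prescribed_card
    (G : Type) [Group G] [Countable G] [Infinite G]
    (S : Finset G) (hS : ∀ s ∈ S, s⁻¹ ∈ S)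
    (hgen : Subgroup.closure (S : Set G) = ⊤)
    (c : ℝ) (hc : 0 < c) (d : ℕ)
    (hpoly : ∀ k : ℕ, 1 ≤ k → ((wordBall S k).ncard : ℝ) ≤ c * (k : ℝ) ^ d)
    (a : ℕ → ℕ) (ha : StrictMono a) (hapos : ∀ n, 0 < a n) :
    ∃ F : ℕ → Set G,
      IsFolnerSeq (MulAction.toPermHom G G) F ∧ ∀ n, (F n).ncard = a n := by
  have hlarge (j : ℕ) : ∃ N : ℕ, ∀ m ≥ N, ∃ F : Finset G, F.card = m ∧
      ∀ g ∈ wordBall S j, ((escapeSet g F).card : ℝ) ≤ 1 / ((j : ℝ) + 1) * F.card := by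
    have hε : (0 : ℝ) < 1 / ((j : ℝ) + 1) := Nat.one_div_pos_of_nat
    obtain ⟨E, hE, hesc⟩ := exists_card_escapeSet_le hpoly j (half_pos hε)
    exact exists_card_eq_and_escapeSet_le hε hE hesc
  obtain ⟨F, hcard, hF⟩ := exists_seq_card_eq_and_escapeSet_le
    (fun _ _ h => wordBall_mono h) wordBall_zero hlarge
  refine ⟨fun n => F (a n), ⟨fun n => ⟨(F (a n)).finite_toSet, ?_⟩, fun g => ?_⟩, fun n => ?_⟩
  · rw [Finset.coe_nonempty, ← Finset.card_pos, hcard]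
    exact hapos n
  · obtain ⟨k, hk⟩ := exists_mem_wordBall hS hgen g
    simp only [ncard_symmDiff_image_eq, Set.ncard_coe_finset, hcard]
    refine Filter.Tendsto.comp
      (g := fun m : ℕ => ((2 * (escapeSet g (F m)).card : ℕ) : ℝ) / m) ?_ ha.tendsto_atTop
    rw [Metric.tendsto_nhds]
    intro ε hε
    obtain ⟨i, hi⟩ := exists_nat_one_div_lt (half_pos hε)
    filter_upwards [hF (max i k), Filter.eventually_gt_atTop 0] with m hm hm0
    have hm0' : (0 : ℝ) < m := by exact_mod_cast hm0
    have hle : 1 / (((max i k : ℕ) : ℝ) + 1) ≤ 1 / ((i : ℝ) + 1) :=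
      Nat.one_div_le_one_div (le_max_left i k)
    have hesc := hm g (wordBall_mono (le_max_right i k) hk)
    rw [Real.dist_0_eq_abs, abs_of_nonneg (by positivity), div_lt_iff₀ hm0']
    push_cast
    have := mul_lt_mul_of_pos_right (hle.trans_lt hi) hm0'
    linarith
  · rw [Set.ncard_coe_finset, hcard]
end
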